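/- arXiv:1712.09590 — 3 statements merged into one kernel-verified Lean document; each statement's English description precedes it below -/
import Mathlib

section
/- Let n ≥ 1, A > 0. For every M > 0 and ε > 0 there exists a constant C = C(M, ε, n, A) with the following property: for all x₀ ∈ ℝⁿ, all ρ > 0, all s₁ < s₂, and every u ∈ C³(Ω) solving u_t = Σ_{i,j=1}^n (δ_{ij} − u_{x_i}u_{x_j}/(1 + |∇u|²))·u_{x_i x_j} ± A·√(1 + |∇u|²) in Ω = B_ρ(x₀) × (s₁, s₂) (with either choice of sign, fixed throughout Ω) and satisfying sup over the closure of Ω of |u| ≤ M, one has |∇u(x, t)| ≤ C for all (x, t) ∈ B_{ρ−ε}(x₀) × (s₁ + ε², s₂). -/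
/-- Spatial partial derivative `∂u/∂xᵢ` of `u(·, t)` at `x`. -/
noncomputable def pd {n : ℕ} (u : EuclideanSpace ℝ (Fin n) → ℝ → ℝ) (t : ℝ)
    (x : EuclideanSpace ℝ (Fin n)) (i : Fin n) : ℝ :=
  fderiv ℝ (fun y => u y t) x (EuclideanSpace.single i 1)

/-- Spatial second partial derivative `∂²u/∂xᵢ∂xⱼ` of `u(·, t)` at `x`. -/
noncomputable def pd2 {n : ℕ} (u : EuclideanSpace ℝ (Fin n) → ℝ → ℝ) (t : ℝ)
    (x : EuclideanSpace ℝ (Fin n)) (i j : Fin n) : ℝ :=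
  fderiv ℝ (fun y => pd u t y j) x (EuclideanSpace.single i 1)

open Filter Topology

theorem secondDeriv_nonpos_of_isLocalMax {f f' : ℝ → ℝ} {x c : ℝ}
    (hf : ∀ᶠ s in 𝓝 x, HasDerivAt f (f' s) s) (hf' : HasDerivAt f' c x)
    (hmax : IsLocalMax f x) : c ≤ 0 := by
  by_contra! hc
  have hderiv : deriv f =ᶠ[𝓝 x] f' := hf.mono fun s hs => hs.deriv
  have hmin : IsLocalMin f x := by
    refine isLocalMin_of_deriv_deriv_pos ?_ hmax.deriv_eq_zero hf.self_of_nhds.continuousAt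
    rwa [hderiv.deriv_eq, hf'.deriv]
  have hconst : f =ᶠ[𝓝 x] fun _ => f x := by
    filter_upwards [hmax, hmin] with s h₁ h₂ using le_antisymm h₁ h₂
  have hzero : f' =ᶠ[𝓝 x] fun _ => 0 := by
    filter_upwards [hconst.eventuallyEq_nhds, hderiv] with s h₁ h₂
    rw [← h₂, h₁.deriv_eq, deriv_const]
  have := hf'.unique ((hasDerivAt_const x (0 : ℝ)).congr_of_eventuallyEq hzero)
  exact hc.ne' this

theorem deriv_nonneg_of_eventually_le_left {f : ℝ → ℝ} {x c : ℝ}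
    (hf : HasDerivAt f c x) (hmax : ∀ᶠ s in 𝓝[<] x, f s ≤ f x) : 0 ≤ c := by
  refine ge_of_tendsto (hasDerivAt_iff_tendsto_slope_left_right.1 hf).1 ?_
  filter_upwards [hmax, self_mem_nhdsWithin] with s h₁ h₂
  rw [slope_def_field]
  exact div_nonneg_of_nonpos (sub_nonpos.2 h₁) (sub_nonpos.2 (le_of_lt h₂))

theorem hasDerivAt_line {F G : Type*} [NormedAddCommGroup F] [NormedSpace ℝ F]
    [NormedAddCommGroup G] [NormedSpace ℝ G] {f : F → G} {z d : F} {s : ℝ}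
    (hf : DifferentiableAt ℝ f (z + s • d)) :
    HasDerivAt (fun r => f (z + r • d)) (fderiv ℝ f (z + s • d) d) s := by
  have hl : HasDerivAt (fun r : ℝ => z + r • d) d s := by
    simpa using ((hasDerivAt_id s).smul_const d).const_add z
  exact hf.hasFDerivAt.comp_hasDerivAt s hl

theorem contDiffAt_fderiv {F : Type*} [NormedAddCommGroup F] [NormedSpace ℝ F] {U : F → ℝ} {z : F}
    (hU : ContDiffAt ℝ 3 U z) : ContDiffAt ℝ 2 (fderiv ℝ U) z :=
  hU.fderiv_right (by norm_num)

theorem differentiableAt_fderiv {F : Type*} [NormedAddCommGroup F] [NormedSpace ℝ F] {U : F → ℝ}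
    {z : F} (hU : ContDiffAt ℝ 3 U z) : DifferentiableAt ℝ (fderiv ℝ U) z :=
  (contDiffAt_fderiv hU).differentiableAt (by norm_num)

theorem differentiableAt_fderiv_fderiv {F : Type*} [NormedAddCommGroup F] [NormedSpace ℝ F]
    {U : F → ℝ} {z : F} (hU : ContDiffAt ℝ 3 U z) :
    DifferentiableAt ℝ (fderiv ℝ (fderiv ℝ U)) z :=
  ((contDiffAt_fderiv hU).fderiv_right (m := 1) (by norm_num)).differentiableAt (by norm_num)

theorem fderiv_fderiv_comm {F : Type*} [NormedAddCommGroup F] [NormedSpace ℝ F] {U : F → ℝ} {z : F}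
    (hU : ContDiffAt ℝ 3 U z) (d d' : F) :
    fderiv ℝ (fderiv ℝ U) z d d' = fderiv ℝ (fderiv ℝ U) z d' d :=
  (hU.isSymmSndFDerivAt (by simp; norm_num)).eq d d'

section Space

variable {E : Type*} [NormedAddCommGroup E] [InnerProductSpace ℝ E]

/-- Spatial gradient of a function on space-time. -/
noncomputable def spatialGradient [CompleteSpace E] (U : E × ℝ → ℝ) (z : E × ℝ) : E :=
  (InnerProductSpace.toDual ℝ E).symm ((fderiv ℝ U z).comp (.inl ℝ E ℝ))

/-- Spatial Hessian of a function on space-time. -/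
noncomputable def spatialHessian (U : E × ℝ → ℝ) (z : E × ℝ) : E →L[ℝ] E →L[ℝ] ℝ :=
  (ContinuousLinearMap.precomp ℝ (.inl ℝ E ℝ)).comp ((fderiv ℝ (fderiv ℝ U) z).comp (.inl ℝ E ℝ))

theorem inner_spatialGradient [CompleteSpace E] (U : E × ℝ → ℝ) (z : E × ℝ) (b : E) :
    inner ℝ (spatialGradient U z) b = fderiv ℝ U z (b, 0) := by
  simp [spatialGradient]

theorem spatialHessian_apply (U : E × ℝ → ℝ) (z : E × ℝ) (b c : E) :
    spatialHessian U z b c = fderiv ℝ (fderiv ℝ U) z (b, 0) (c, 0) := by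
  simp [spatialHessian]

theorem differentiableAt_spatialGradient [CompleteSpace E] {U : E × ℝ → ℝ}
    {z : E × ℝ} (hU : ContDiffAt ℝ 3 U z) : DifferentiableAt ℝ (spatialGradient U) z := by
  have h := differentiableAt_fderiv hU
  have h' : DifferentiableAt ℝ (fun z => (fderiv ℝ U z).comp (.inl ℝ E ℝ)) z := by fun_prop
  exact (InnerProductSpace.toDual ℝ E).symm.differentiableAt.comp z h'

theorem inner_fderiv_spatialGradient [CompleteSpace E] {U : E × ℝ → ℝ}
    {z : E × ℝ} (hU : ContDiffAt ℝ 3 U z) (d : E × ℝ) (b : E) :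
    inner ℝ (fderiv ℝ (spatialGradient U) z d) b = fderiv ℝ (fderiv ℝ U) z d (b, 0) := by
  have h := differentiableAt_fderiv hU
  have h₁ := (differentiableAt_spatialGradient hU).hasFDerivAt.inner ℝ (hasFDerivAt_const b z)
  have h₂ := h.hasFDerivAt.clm_apply (hasFDerivAt_const ((b, 0) : E × ℝ) z)
  simp only [inner_spatialGradient] at h₁
  simpa using DFunLike.congr_fun (h₁.unique h₂) d

theorem differentiableAt_spatialHessian {U : E × ℝ → ℝ} {z : E × ℝ} (hU : ContDiffAt ℝ 3 U z) :
    DifferentiableAt ℝ (spatialHessian U) z := by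
  have h := differentiableAt_fderiv_fderiv hU
  exact (differentiableAt_const _).clm_comp (h.clm_comp (differentiableAt_const _))

theorem fderiv_spatialHessian_apply {U : E × ℝ → ℝ} {z : E × ℝ} (hU : ContDiffAt ℝ 3 U z)
    (d : E × ℝ) (b c : E) :
    fderiv ℝ (spatialHessian U) z d b c =
      fderiv ℝ (fderiv ℝ (fderiv ℝ U)) z d (b, 0) (c, 0) := by
  have h := differentiableAt_fderiv_fderiv hU
  have h₁ := ((differentiableAt_spatialHessian hU).hasFDerivAt.clm_apply
    (hasFDerivAt_const b z)).clm_apply (hasFDerivAt_const c z)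
  have h₂ := (h.hasFDerivAt.clm_apply (hasFDerivAt_const ((b, 0) : E × ℝ) z)).clm_apply
    (hasFDerivAt_const ((c, 0) : E × ℝ) z)
  simp only [spatialHessian_apply] at h₁
  simpa using DFunLike.congr_fun (h₁.unique h₂) d

theorem fderiv_spatialHessian_swap {U : E × ℝ → ℝ} {z : E × ℝ} (hU : ContDiffAt ℝ 3 U z)
    (b q : E) :
    fderiv ℝ (spatialHessian U) z (b, 0) q b = fderiv ℝ (spatialHessian U) z (q, 0) b b := by
  rw [fderiv_spatialHessian_apply hU, fderiv_spatialHessian_apply hU,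
    ((contDiffAt_fderiv hU).isSymmSndFDerivAt (by simp)).eq]

section Trace

variable {ι : Type*} [Fintype ι]

theorem sum_clm_sub_div_nonpos (e : OrthonormalBasis ι ℝ E) (H : E →L[ℝ] E →L[ℝ] ℝ)
    (hH : ∀ b, H b b ≤ 0) (q : E) :
    ∑ i, H (e i) (e i) - H q q / (1 + ‖q‖ ^ 2) ≤ 0 := by
  set v := √(1 + ‖q‖ ^ 2) with hv
  have hv2 : v ^ 2 = 1 + ‖q‖ ^ 2 := Real.sq_sqrt (by positivity)
  have hv0 : 0 < v := Real.sqrt_pos.2 (by positivity)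
  set c := 1 / (v * (v + 1)) with hc
  have h₁ : ∑ i, inner ℝ (e i) q * H (e i) q = H q q := by
    simpa using congrArg (fun b => H b q) (e.sum_repr' q)
  have h₂ : ∑ i, inner ℝ (e i) q * H q (e i) = H q q := by
    simpa using congrArg (H q) (e.sum_repr' q)
  have h₃ : ∑ i, inner ℝ (e i) q ^ 2 = ‖q‖ ^ 2 := by
    simpa using e.sum_sq_norm_inner_right q
  have h₄ : ∑ i, H (e i - (c * inner ℝ (e i) q) • q) (e i - (c * inner ℝ (e i) q) • q)
      = ∑ i, H (e i) (e i) - 2 * c * H q q + c ^ 2 * ‖q‖ ^ 2 * H q q := by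
    have : ∀ i, H (e i - (c * inner ℝ (e i) q) • q) (e i - (c * inner ℝ (e i) q) • q)
        = H (e i) (e i) - c * (inner ℝ (e i) q * H (e i) q) - c * (inner ℝ (e i) q * H q (e i))
          + c ^ 2 * H q q * inner ℝ (e i) q ^ 2 := by
      intro i
      simp only [map_sub, map_smul, sub_apply, smul_apply,
        smul_eq_mul]
      ring
    simp only [this, Finset.sum_add_distrib, Finset.sum_sub_distrib, ← Finset.mul_sum, h₁, h₂, h₃]
    ring
  have h₅ : -2 * c + c ^ 2 * ‖q‖ ^ 2 = -1 / (1 + ‖q‖ ^ 2) := by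
    rw [show ‖q‖ ^ 2 = v ^ 2 - 1 by linarith, hc]
    field_simp
    ring
  calc _ = ∑ i, H (e i) (e i) + (-1 / (1 + ‖q‖ ^ 2)) * H q q := by ring
    _ = _ := by rw [← h₅]; ring
    _ = _ := h₄.symm
    _ ≤ 0 := Finset.sum_nonpos fun i _ => hH _

/-- Differentiating the graph equation in the direction of the gradient. -/
theorem fderiv_graph_equation [CompleteSpace E] (e : OrthonormalBasis ι ℝ E) {U : E × ℝ → ℝ}
    {P : E × ℝ} {B : ℝ} {q w : E} {T : E →L[ℝ] E →L[ℝ] ℝ} (hU : ContDiffAt ℝ 3 U P)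
    (heq : ∀ᶠ z in 𝓝 P, fderiv ℝ U z (0, 1) = ∑ i, spatialHessian U z (e i) (e i)
      - spatialHessian U z (spatialGradient U z) (spatialGradient U z)
        / (1 + ‖spatialGradient U z‖ ^ 2) + B * √(1 + ‖spatialGradient U z‖ ^ 2))
    (hq : spatialGradient U P = q) (hw : fderiv ℝ (spatialGradient U) P (q, 0) = w)
    (hT : fderiv ℝ (spatialHessian U) P (q, 0) = T) :
    fderiv ℝ (fderiv ℝ U) P (0, 1) (q, 0) = ∑ i, T (e i) (e i) - T q q / (1 + ‖q‖ ^ 2)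
      - 2 * ‖w‖ ^ 2 / (1 + ‖q‖ ^ 2) + 2 * inner ℝ q w ^ 2 / (1 + ‖q‖ ^ 2) ^ 2
      + B * inner ℝ q w / √(1 + ‖q‖ ^ 2) := by
  have hP : P + (0 : ℝ) • ((q, 0) : E × ℝ) = P := by simp
  have hcont : Tendsto (fun s : ℝ => P + s • ((q, 0) : E × ℝ)) (𝓝 0) (𝓝 P) := by
    have : Continuous (fun s : ℝ => P + s • ((q, 0) : E × ℝ)) := by fun_prop
    simpa using this.tendsto 0
  have hl : HasDerivAt (fun s : ℝ => fderiv ℝ U (P + s • (q, 0)) (0, 1))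
      (fderiv ℝ (fderiv ℝ U) P (0, 1) (q, 0)) 0 := by
    have h := hasDerivAt_line (d := ((q, 0) : E × ℝ)) (s := 0)
      (hP.symm ▸ differentiableAt_fderiv hU)
    have h' := h.clm_apply (hasDerivAt_const 0 ((0, 1) : E × ℝ))
    rw [fderiv_fderiv_comm hU]
    simpa using h'
  have hg : HasDerivAt (fun s : ℝ => spatialGradient U (P + s • (q, 0))) w 0 := by
    have h := hasDerivAt_line (d := ((q, 0) : E × ℝ)) (s := 0)
      (hP.symm ▸ differentiableAt_spatialGradient hU)
    rwa [hP, hw] at h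
  have hX : HasDerivAt (fun s : ℝ => spatialHessian U (P + s • (q, 0))) T 0 := by
    have h := hasDerivAt_line (f := spatialHessian U) (z := P) (d := ((q, 0) : E × ℝ)) (s := 0)
      (by rw [hP]; exact differentiableAt_spatialHessian hU)
    rwa [hP, hT] at h
  have hXq : ∀ b, spatialHessian U P q b = inner ℝ w b := by
    intro b
    rw [spatialHessian_apply, ← hw, inner_fderiv_spatialGradient hU]
  have hXq' : spatialHessian U P w q = ‖w‖ ^ 2 := by
    rw [spatialHessian_apply, fderiv_fderiv_comm hU, ← spatialHessian_apply, hXq,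
      real_inner_self_eq_norm_sq]
  have htr := HasDerivAt.fun_sum (u := Finset.univ) fun i (_ : i ∈ Finset.univ) =>
    (hX.clm_apply (hasDerivAt_const 0 (e i))).clm_apply (hasDerivAt_const 0 (e i))
  have hquad := (hX.clm_apply hg).clm_apply hg
  have hN := hg.norm_sq.const_add 1
  have hN0 : (1 : ℝ) + ‖spatialGradient U (P + (0 : ℝ) • ((q, 0) : E × ℝ))‖ ^ 2 ≠ 0 := by positivity
  have hr := (htr.sub (hquad.div hN hN0)).add ((hN.sqrt hN0).const_mul B)
  have h := (hl.congr_of_eventuallyEq ((hcont.eventually heq).mono fun s hs => hs.symm)).unique hr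
  rw [h]
  have hv : √(1 + ‖q‖ ^ 2) ≠ 0 := (Real.sqrt_pos.2 (by positivity)).ne'
  have hN1 : 1 + ‖q‖ ^ 2 ≠ 0 := by positivity
  simp only [hP, hq, map_zero, add_zero, add_apply, hXq, hXq',
    real_inner_self_eq_norm_sq, real_inner_comm q w]
  field_simp
  ring

end Trace

theorem isLocalMax_exp_mul {g g' L L' : ℝ → ℝ} {K g₂ L₂ : ℝ}
    (hg : ∀ᶠ s in 𝓝 0, HasDerivAt g (g' s) s) (hg' : HasDerivAt g' g₂ 0)
    (hL : ∀ᶠ s in 𝓝 0, HasDerivAt L (L' s) s) (hL' : HasDerivAt L' L₂ 0)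
    (hmax : IsLocalMax (fun s => (Real.exp (K * g s) - 1) * L s) 0) :
    K * Real.exp (K * g 0) * g' 0 * L 0 + (Real.exp (K * g 0) - 1) * L' 0 = 0 ∧
    K * Real.exp (K * g 0) * ((K * g' 0 ^ 2 + g₂) * L 0 + 2 * g' 0 * L' 0)
      + (Real.exp (K * g 0) - 1) * L₂ ≤ 0 := by
  have h₁ : ∀ᶠ s in 𝓝 0, HasDerivAt (fun s => (Real.exp (K * g s) - 1) * L s)
      (K * Real.exp (K * g s) * g' s * L s + (Real.exp (K * g s) - 1) * L' s) s := by
    filter_upwards [hg, hL] with s hs hs'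
    exact ((((hs.const_mul K).exp).sub_const 1).mul hs').congr_deriv (by ring)
  have hg0 := hg.self_of_nhds
  have hL0 := hL.self_of_nhds
  have h₂ := (((((hg0.const_mul K).exp).const_mul K).mul hg').mul hL0).add
    ((((hg0.const_mul K).exp).sub_const 1).mul hL')
  refine ⟨hmax.hasDerivAt_eq_zero h₁.self_of_nhds, ?_⟩
  have h₃ := secondDeriv_nonpos_of_isLocalMax h₁ h₂ hmax
  simp only [Pi.mul_apply] at h₃
  linarith

/-- The cutoff argument on the parabolic cylinder of radius `ε` with vertex `P₀`, tilted by a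
multiple of `U`. -/
noncomputable def tiltedCutoff (U : E × ℝ → ℝ) (P₀ : E × ℝ) (ε lam M : ℝ) (z : E × ℝ) : ℝ :=
  1 - ‖z.1 - P₀.1‖ ^ 2 / ε ^ 2 - (P₀.2 - z.2) / ε ^ 2 + lam * (U z - M)

theorem hasDerivAt_tiltedCutoff_space [CompleteSpace E] {U : E × ℝ → ℝ} {P P₀ : E × ℝ}
    {ε lam M : ℝ} {b : E} {s : ℝ} (hU : DifferentiableAt ℝ U (P + s • (b, 0))) :
    HasDerivAt (fun r => tiltedCutoff U P₀ ε lam M (P + r • (b, 0)))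
      (-(2 / ε ^ 2) * inner ℝ (P.1 - P₀.1 + s • b) b
        + lam * inner ℝ (spatialGradient U (P + s • (b, 0))) b) s := by
  have h₁ : HasDerivAt (fun r : ℝ => P.1 - P₀.1 + r • b) b s := by
    simpa using ((hasDerivAt_id s).smul_const b).const_add (P.1 - P₀.1)
  have h₂ := ((((h₁.norm_sq.div_const (ε ^ 2)).const_sub 1).sub_const ((P₀.2 - P.2) / ε ^ 2)).add
    (((hasDerivAt_line (f := U) (z := P) (d := ((b, 0) : E × ℝ)) hU).sub_const M).const_mul lam))
  refine (h₂.congr_deriv ?_).congr_of_eventuallyEq (Eventually.of_forall fun r => ?_)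
  · rw [inner_spatialGradient]
    ring
  · simp only [tiltedCutoff, Prod.fst_add, Prod.smul_fst, Prod.snd_add, Prod.smul_snd, smul_zero,
      add_zero, Pi.add_apply]
    rw [add_sub_right_comm]

theorem hasDerivAt_tiltedCutoff_time {U : E × ℝ → ℝ} {P P₀ : E × ℝ}
    {ε lam M : ℝ} (hU : DifferentiableAt ℝ U P) :
    HasDerivAt (fun r : ℝ => tiltedCutoff U P₀ ε lam M (P + r • (0, 1)))
      (1 / ε ^ 2 + lam * fderiv ℝ U P (0, 1)) 0 := by
  have hP : P + (0 : ℝ) • ((0, 1) : E × ℝ) = P := by simp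
  have h₁ : HasDerivAt (fun r : ℝ => P₀.2 - (P.2 + r)) (-1) 0 := by
    simpa using ((hasDerivAt_id (0 : ℝ)).const_add P.2).const_sub P₀.2
  have h₂ := hasDerivAt_line (f := U) (z := P) (d := ((0, 1) : E × ℝ)) (s := 0) (by rwa [hP])
  rw [hP] at h₂
  have h₃ := ((h₁.div_const (ε ^ 2)).const_sub (1 - ‖P.1 - P₀.1‖ ^ 2 / ε ^ 2)).add
    ((h₂.sub_const M).const_mul lam)
  have h₄ := h₃.congr_deriv (g' := 1 / ε ^ 2 + lam * fderiv ℝ U P (0, 1))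
    (by rw [neg_div, neg_neg])
  refine h₄.congr_of_eventuallyEq (Eventually.of_forall fun r => ?_)
  simp [tiltedCutoff]

theorem tendsto_line {F : Type*} [NormedAddCommGroup F] [NormedSpace ℝ F] (P d : F) :
    Tendsto (fun s : ℝ => P + s • d) (𝓝 0) (𝓝 P) := by
  have : Continuous (fun s : ℝ => P + s • d) := by fun_prop
  simpa using this.tendsto 0

/-- First and second order conditions in space, and first order condition in time, at a maximum of
the cutoff times the linearised area element. -/
theorem maximum_conditions [CompleteSpace E] {U : E × ℝ → ℝ} {P P₀ : E × ℝ} {q w : E}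
    {X T : E →L[ℝ] E →L[ℝ] ℝ} {K ε lam M η : ℝ} (hU : ContDiffAt ℝ 3 U P)
    (hq : spatialGradient U P = q) (hX : spatialHessian U P = X)
    (hw : fderiv ℝ (spatialGradient U) P (q, 0) = w)
    (hT : fderiv ℝ (spatialHessian U) P (q, 0) = T)
    (hη : Real.exp (K * tiltedCutoff U P₀ ε lam M P) - 1 = η)
    (hmax : ∀ᶠ z in 𝓝 P, z.2 ≤ P.2 →
      (Real.exp (K * tiltedCutoff U P₀ ε lam M z) - 1) * (1 + inner ℝ (spatialGradient U z) q) ≤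
      (Real.exp (K * tiltedCutoff U P₀ ε lam M P) - 1) * (1 + inner ℝ (spatialGradient U P) q)) :
    (∀ b, K * (η + 1) * (1 + ‖q‖ ^ 2) * inner ℝ (lam • q - (2 / ε ^ 2) • (P.1 - P₀.1)) b
        + η * inner ℝ w b = 0) ∧
    (∀ b, K * (η + 1) * ((K * inner ℝ (lam • q - (2 / ε ^ 2) • (P.1 - P₀.1)) b ^ 2
          + (lam * X b b - 2 / ε ^ 2 * ‖b‖ ^ 2)) * (1 + ‖q‖ ^ 2)
          + 2 * inner ℝ (lam • q - (2 / ε ^ 2) • (P.1 - P₀.1)) b * inner ℝ w b)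
        + η * T b b ≤ 0) ∧
    0 ≤ K * (η + 1) * (1 / ε ^ 2 + lam * fderiv ℝ U P (0, 1)) * (1 + ‖q‖ ^ 2)
      + η * fderiv ℝ (fderiv ℝ U) P (0, 1) (q, 0) := by
  have hexp : Real.exp (K * tiltedCutoff U P₀ ε lam M P) = η + 1 := by linarith
  have hev : ∀ᶠ z in 𝓝 P, ContDiffAt ℝ 3 U z := hU.eventually (by simp)
  have hP : ∀ d : E × ℝ, P + (0 : ℝ) • d = P := by simp
  have hspace : ∀ b, _ ∧ _ := fun b => by
    have hline := tendsto_line P ((b, 0) : E × ℝ)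
    have hg : ∀ᶠ s : ℝ in 𝓝 0, HasDerivAt
        (fun r => tiltedCutoff U P₀ ε lam M (P + r • (b, 0)))
        (-(2 / ε ^ 2) * inner ℝ (P.1 - P₀.1 + s • b) b
          + lam * inner ℝ (spatialGradient U (P + s • (b, 0))) b) s := by
      filter_upwards [hline.eventually hev] with s hs
      exact hasDerivAt_tiltedCutoff_space (hs.differentiableAt (by norm_num))
    have hg' : HasDerivAt (fun s : ℝ => -(2 / ε ^ 2) * inner ℝ (P.1 - P₀.1 + s • b) b
          + lam * inner ℝ (spatialGradient U (P + s • (b, 0))) b)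
        (lam * X b b - 2 / ε ^ 2 * ‖b‖ ^ 2) 0 := by
      have h₁ : HasDerivAt (fun r : ℝ => P.1 - P₀.1 + r • b) b 0 := by
        simpa using ((hasDerivAt_id (0 : ℝ)).smul_const b).const_add (P.1 - P₀.1)
      have h₂ := hasDerivAt_line (f := spatialGradient U) (z := P) (d := ((b, 0) : E × ℝ))
        (s := 0) (by rw [hP]; exact differentiableAt_spatialGradient hU)
      have h₃ := ((h₁.inner ℝ (hasDerivAt_const 0 b)).const_mul (-(2 / ε ^ 2))).add
        ((h₂.inner ℝ (hasDerivAt_const 0 b)).const_mul lam)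
      refine h₃.congr_deriv ?_
      rw [hP, inner_fderiv_spatialGradient hU, ← spatialHessian_apply, hX]
      simp only [inner_zero_right, zero_add, real_inner_self_eq_norm_sq]
      ring
    have hL : ∀ᶠ s : ℝ in 𝓝 0, HasDerivAt
        (fun r => 1 + inner ℝ (spatialGradient U (P + r • (b, 0))) q)
        (spatialHessian U (P + s • (b, 0)) q b) s := by
      filter_upwards [hline.eventually hev] with s hs
      have h₂ := hasDerivAt_line (differentiableAt_spatialGradient hs)
      refine ((h₂.inner ℝ (hasDerivAt_const s q)).const_add 1).congr_deriv ?_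
      rw [inner_fderiv_spatialGradient hs, fderiv_fderiv_comm hs, ← spatialHessian_apply]
      simp
    have hL' : HasDerivAt (fun s : ℝ => spatialHessian U (P + s • (b, 0)) q b) (T b b) 0 := by
      have h := hasDerivAt_line (f := spatialHessian U) (z := P) (d := ((b, 0) : E × ℝ)) (s := 0)
        (by rw [hP]; exact differentiableAt_spatialHessian hU)
      have h' := (h.clm_apply (hasDerivAt_const 0 q)).clm_apply (hasDerivAt_const 0 b)
      refine h'.congr_deriv ?_
      rw [hP, ← hT, ← fderiv_spatialHessian_swap hU]
      simp
    have hm : IsLocalMax (fun s : ℝ =>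
        (Real.exp (K * tiltedCutoff U P₀ ε lam M (P + s • (b, 0))) - 1)
          * (1 + inner ℝ (spatialGradient U (P + s • (b, 0))) q)) 0 := by
      filter_upwards [hline.eventually hmax] with s hs
      simpa using hs (by simp)
    exact isLocalMax_exp_mul hg hg' hL hL' hm
  have hwb : ∀ b, X q b = inner ℝ w b := fun b => by
    rw [← hw, inner_fderiv_spatialGradient hU, ← spatialHessian_apply, hX]
  simp only [zero_smul, add_zero, hexp, hX, hq, add_sub_cancel_right, hwb,
    real_inner_self_eq_norm_sq] at hspace
  have hD : ∀ b, inner ℝ (lam • q - (2 / ε ^ 2) • (P.1 - P₀.1)) b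
      = -(2 / ε ^ 2) * inner ℝ (P.1 - P₀.1) b + lam * inner ℝ q b := fun b => by
    rw [inner_sub_left, real_inner_smul_left, real_inner_smul_left]
    ring
  simp only [hD]
  refine ⟨fun b => ?_, fun b => (hspace b).2, ?_⟩
  · linarith [(hspace b).1]
  · have hg := hasDerivAt_tiltedCutoff_time (P₀ := P₀) (ε := ε) (lam := lam) (M := M)
      (hU.differentiableAt (by norm_num))
    have h₂ := hasDerivAt_line (f := spatialGradient U) (z := P) (d := ((0, 1) : E × ℝ))
      (s := 0) (by rw [hP]; exact differentiableAt_spatialGradient hU)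
    have h₃ := (((hg.const_mul K).exp).sub_const 1).mul
      ((h₂.inner ℝ (hasDerivAt_const 0 q)).const_add 1)
    have h₄ := deriv_nonneg_of_eventually_le_left h₃ (by
      filter_upwards [((tendsto_line P ((0, 1) : E × ℝ)).eventually hmax).filter_mono
        nhdsWithin_le_nhds, self_mem_nhdsWithin] with s hs hs0
      have hs0' : s ≤ 0 := le_of_lt hs0
      simpa [Prod.mk_zero_zero] using hs (by simpa using hs0'))
    rw [hP, inner_fderiv_spatialGradient hU, hexp, hq, real_inner_self_eq_norm_sq,
      inner_zero_right, zero_add] at h₄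
    linarith

theorem tilted_ellipticity_le {ι : Type*} [Fintype ι] [CompleteSpace E] (e : OrthonormalBasis ι ℝ E)
    {U : E × ℝ → ℝ} {P P₀ : E × ℝ} {q : E} {K ε lam M A B : ℝ} (hU : ContDiffAt ℝ 3 U P)
    (heq : ∀ᶠ z in 𝓝 P, fderiv ℝ U z (0, 1) = ∑ i, spatialHessian U z (e i) (e i)
      - spatialHessian U z (spatialGradient U z) (spatialGradient U z)
        / (1 + ‖spatialGradient U z‖ ^ 2) + B * √(1 + ‖spatialGradient U z‖ ^ 2))
    (hq : spatialGradient U P = q) (hK : 0 < K) (hε : 0 < ε) (hlam : 0 < lam) (hB : |B| ≤ A)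
    (hy : ‖P.1 - P₀.1‖ ≤ ε) (hpos : 0 < tiltedCutoff U P₀ ε lam M P)
    (hmax : ∀ᶠ z in 𝓝 P, z.2 ≤ P.2 →
      (Real.exp (K * tiltedCutoff U P₀ ε lam M z) - 1) * (1 + inner ℝ (spatialGradient U z) q) ≤
      (Real.exp (K * tiltedCutoff U P₀ ε lam M P) - 1) * (1 + inner ℝ (spatialGradient U P) q)) :
    K * (lam ^ 2 * (1 - 1 / (1 + ‖q‖ ^ 2)) - 4 * lam / (ε * √(1 + ‖q‖ ^ 2))) ≤
      (1 + 2 * Fintype.card ι) / ε ^ 2 + lam * A + 2 * A / ε := by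
  set X := spatialHessian U P with hX
  set w := fderiv ℝ (spatialGradient U) P (q, 0) with hw
  set T := fderiv ℝ (spatialHessian U) P (q, 0) with hT
  set η := Real.exp (K * tiltedCutoff U P₀ ε lam M P) - 1 with hη
  obtain ⟨hfirst, hsecond, htime⟩ :=
    maximum_conditions hU hq hX.symm hw.symm hT.symm hη.symm hmax
  have hlin := fderiv_graph_equation e hU heq hq hw.symm hT.symm
  have heqP := heq.self_of_nhds
  rw [hq, ← hX] at heqP
  have hη0 : 0 < η := by
    have := Real.add_one_le_exp (K * tiltedCutoff U P₀ ε lam M P)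
    have := mul_pos hK hpos
    linarith
  clear_value η
  set y := P.1 - P₀.1 with hydef
  set D := lam • q - (2 / ε ^ 2) • y with hD
  set N := 1 + ‖q‖ ^ 2 with hN
  have hN1 : 1 ≤ N := by linarith [sq_nonneg ‖q‖]
  have hN0 : 0 < N := by linarith
  set S := K * (η + 1) with hS
  have hS0 : 0 < S := by positivity
  obtain ⟨κ, hκ⟩ : ∃ κ, η * κ = S * N := ⟨S * N / η, by field_simp⟩
  have hwD : w = -κ • D := by
    refine ext_inner_right ℝ fun b => ?_
    rw [real_inner_smul_left]
    refine mul_left_cancel₀ hη0.ne' ?_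
    linear_combination hfirst b + inner ℝ D b * hκ
  let G : E →L[ℝ] E →L[ℝ] ℝ := isBoundedBilinearMap_inner.toContinuousLinearMap
  have hG : ∀ b c, G b c = inner ℝ b c := fun _ _ => rfl
  have htrace := sum_clm_sub_div_nonpos e
    ((S * K * N - 2 * S * κ) • (innerSL ℝ D).smulRight (innerSL ℝ D)
      + (S * lam * N) • X - (S * N * (2 / ε ^ 2)) • G + η • T) (fun b => by
      have := hsecond b
      rw [hwD, real_inner_smul_left] at this
      simp only [add_apply, sub_apply, smul_apply, ContinuousLinearMap.smulRight_apply,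
        innerSL_apply_apply, smul_eq_mul, hG, real_inner_self_eq_norm_sq]
      linarith) q
  simp only [add_apply, sub_apply, smul_apply, ContinuousLinearMap.smulRight_apply,
        innerSL_apply_apply, smul_eq_mul, hG, real_inner_self_eq_norm_sq, Finset.sum_add_distrib,
        Finset.sum_sub_distrib, ← Finset.mul_sum, ← pow_two, e.sum_sq_inner_left, e.norm_eq_one,
        one_pow, Finset.sum_const, Finset.card_univ, nsmul_eq_mul, mul_one] at htrace
  rw [← hN] at htrace
  have hqw : inner ℝ q w = -κ * inner ℝ D q := by
    rw [hwD, real_inner_smul_right, real_inner_comm]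
  have hww : ‖w‖ ^ 2 = κ ^ 2 * ‖D‖ ^ 2 := by
    rw [hwD, norm_smul, mul_pow, Real.norm_eq_abs, sq_abs, neg_sq]
  set v := √N with hv
  have hv2 : N = v ^ 2 := (Real.sq_sqrt hN0.le).symm
  have hv1 : 1 ≤ v := Real.one_le_sqrt.2 hN1
  have hv0 : 0 < v := by linarith
  have hmixed : η * fderiv ℝ (fderiv ℝ U) P (0, 1) (q, 0) =
      η * ∑ i, T (e i) (e i) - η * T q q / N - 2 * S * κ * ‖D‖ ^ 2
        + 2 * S * κ * inner ℝ D q ^ 2 / N - B * S * N * inner ℝ D q / v := by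
    rw [hlin, hqw, hww]
    calc _ = η * ∑ i, T (e i) (e i) - η * T q q / N + (η * κ) * (-2 * κ * ‖D‖ ^ 2 / N
          + 2 * κ * inner ℝ D q ^ 2 / N ^ 2 - B * inner ℝ D q / v) := by ring
      _ = _ := by rw [hκ]; field_simp; ring
  have hkey : 0 ≤ 1 / ε ^ 2 + lam * B * v + 2 / ε ^ 2 * (Fintype.card ι - ‖q‖ ^ 2 / N)
      - K * (‖D‖ ^ 2 - inner ℝ D q ^ 2 / N) - B * inner ℝ D q / v := by
    refine nonneg_of_mul_nonneg_right (a := S * N) ?_ (by positivity)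
    rw [hmixed, heqP] at htime
    refine (sub_nonneg.2 (htrace.trans htime)).trans_eq ?_
    field_simp
    ring
  set p := inner ℝ y q with hp
  have hDq : inner ℝ D q = lam * ‖q‖ ^ 2 - 2 / ε ^ 2 * p := by
    rw [hD, inner_sub_left, real_inner_smul_left, real_inner_smul_left,
      real_inner_self_eq_norm_sq]
  have hDD : ‖D‖ ^ 2 = lam ^ 2 * ‖q‖ ^ 2 - 4 * lam / ε ^ 2 * p + 4 / ε ^ 4 * ‖y‖ ^ 2 := by
    rw [hD, norm_sub_sq_real, real_inner_smul_left, real_inner_smul_right, real_inner_comm,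
      norm_smul, norm_smul, mul_pow, mul_pow, Real.norm_eq_abs, Real.norm_eq_abs, sq_abs, sq_abs]
    ring
  have hqv : ‖q‖ ≤ v := Real.le_sqrt_of_sq_le (by linarith)
  have hpabs : |p| ≤ ‖y‖ * ‖q‖ := abs_real_inner_le_norm y q
  have hpv : |p| ≤ ε * v := hpabs.trans (by gcongr)
  have hp2 : p ^ 2 ≤ ‖y‖ ^ 2 * N := by
    rw [← sq_abs]
    calc |p| ^ 2 ≤ (‖y‖ * v) ^ 2 := by gcongr; exact hpabs.trans (by gcongr)
      _ = ‖y‖ ^ 2 * N := by rw [hv2]; ring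
  have hqN : ‖q‖ ^ 2 = v ^ 2 - 1 := by linarith
  have hell : lam ^ 2 * (1 - 1 / N) - 4 * lam / (ε * v) ≤ ‖D‖ ^ 2 - inner ℝ D q ^ 2 / N := by
    have h₁ : ‖D‖ ^ 2 - inner ℝ D q ^ 2 / N = lam ^ 2 * (1 - 1 / N) - 4 * lam / (ε ^ 2 * v ^ 2) * p
        + 4 / ε ^ 4 * ((‖y‖ ^ 2 * N - p ^ 2) / N) := by
      rw [hDD, hDq, hqN, hv2]
      field_simp
      ring
    have h₂ : 4 * lam / (ε ^ 2 * v ^ 2) * p ≤ 4 * lam / (ε ^ 2 * v ^ 2) * (ε * v) := by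
      gcongr
      exact (le_abs_self p).trans hpv
    have h₃ : 4 * lam / (ε ^ 2 * v ^ 2) * (ε * v) = 4 * lam / (ε * v) := by field_simp
    have h₄ : 0 ≤ 4 / ε ^ 4 * ((‖y‖ ^ 2 * N - p ^ 2) / N) :=
      mul_nonneg (by positivity) (div_nonneg (by linarith) hN0.le)
    linarith
  have hdrift : lam * B * v - B * inner ℝ D q / v ≤ lam * A + 2 * A / ε := by
    have hA : 0 ≤ A := (abs_nonneg B).trans hB
    have h₁ : lam * B * v - B * inner ℝ D q / v = lam * (B * (1 / v)) + 2 / ε ^ 2 * (B * (p / v)) := by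
      rw [hDq, hqN]
      field_simp
      ring
    have h₂ : B * (1 / v) ≤ A * 1 := by
      refine (le_abs_self _).trans ?_
      rw [abs_mul, abs_of_pos (by positivity : 0 < 1 / v)]
      exact mul_le_mul hB ((div_le_one hv0).2 hv1) (by positivity) hA
    have h₃ : B * (p / v) ≤ A * ε := by
      refine (le_abs_self _).trans ?_
      rw [abs_mul, abs_div, abs_of_pos hv0]
      exact mul_le_mul hB ((div_le_iff₀ hv0).2 hpv) (by positivity) hA
    calc _ = _ := h₁
      _ ≤ lam * (A * 1) + 2 / ε ^ 2 * (A * ε) := by gcongr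
      _ = _ := by field_simp
  have hcard : 2 / ε ^ 2 * (Fintype.card ι - ‖q‖ ^ 2 / N) ≤ 2 / ε ^ 2 * Fintype.card ι := by
    gcongr
    linarith [div_nonneg (sq_nonneg ‖q‖) hN0.le]
  calc _ ≤ K * (‖D‖ ^ 2 - inner ℝ D q ^ 2 / N) := by gcongr
    _ ≤ 1 / ε ^ 2 + 2 / ε ^ 2 * Fintype.card ι + (lam * A + 2 * A / ε) := by linarith
    _ = _ := by ring

theorem one_add_inner_le_sqrt_mul_sqrt (p q : E) :
    1 + inner ℝ p q ≤ √(1 + ‖p‖ ^ 2) * √(1 + ‖q‖ ^ 2) := by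
  rw [← Real.sqrt_mul (by positivity)]
  refine Real.le_sqrt_of_sq_le ?_
  have h := abs_le_abs (real_inner_le_norm p q) (neg_le.1 (neg_le_of_abs_le
    (abs_real_inner_le_norm p q)))
  rw [← sq_le_sq] at h
  nlinarith [real_inner_le_norm p q, sq_nonneg (‖p‖ - ‖q‖)]

/-- Interior gradient bound at the vertex of a parabolic cylinder. -/
theorem sqrt_one_add_norm_spatialGradient_sq_le {ι : Type*} [Fintype ι] [ProperSpace E]
    (e : OrthonormalBasis ι ℝ E) {A B M ε K C₁ V : ℝ} (hM : 0 < M) (hε : 0 < ε) (hB : |B| ≤ A)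
    (hC₁ : C₁ = (1 + 2 * Fintype.card ι) / ε ^ 2 + 1 / (4 * M) * A + 2 * A / ε)
    (hK : K = 4 * (C₁ + 1) / (1 / (4 * M)) ^ 2) (hV : V = max 2 (8 / (ε * (1 / (4 * M)))))
    {U : E × ℝ → ℝ} {P₀ : E × ℝ}
    (hU : ∀ z ∈ Metric.closedBall P₀.1 ε ×ˢ Set.Icc (P₀.2 - ε ^ 2) P₀.2, ContDiffAt ℝ 3 U z)
    (heq : ∀ P ∈ Metric.closedBall P₀.1 ε ×ˢ Set.Icc (P₀.2 - ε ^ 2) P₀.2, ∀ᶠ z in 𝓝 P,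
      fderiv ℝ U z (0, 1) = ∑ i, spatialHessian U z (e i) (e i)
      - spatialHessian U z (spatialGradient U z) (spatialGradient U z)
        / (1 + ‖spatialGradient U z‖ ^ 2) + B * √(1 + ‖spatialGradient U z‖ ^ 2))
    (hbound : ∀ z ∈ Metric.closedBall P₀.1 ε ×ˢ Set.Icc (P₀.2 - ε ^ 2) P₀.2, |U z| ≤ M) :
    √(1 + ‖spatialGradient U P₀‖ ^ 2) ≤ Real.exp K * V / (Real.exp (K / 2) - 1) := by
  have hA : 0 ≤ A := (abs_nonneg B).trans hB
  have hC₁0 : 0 ≤ C₁ := by rw [hC₁]; positivity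
  set lam := 1 / (4 * M) with hlam
  have hlam0 : 0 < lam := by positivity
  have hlamM : lam * M = 1 / 4 := by rw [hlam]; field_simp
  have hK0 : 0 < K := by rw [hK]; positivity
  have hV0 : 0 < V := by rw [hV]; positivity
  set Q := Metric.closedBall P₀.1 ε ×ˢ Set.Icc (P₀.2 - ε ^ 2) P₀.2 with hQ
  have hQc : IsCompact Q := (isCompact_closedBall _ _).prod isCompact_Icc
  have hP₀ : P₀ ∈ Q := ⟨Metric.mem_closedBall_self hε.le, by simp [sq_nonneg], le_rfl⟩
  set g := tiltedCutoff U P₀ ε lam M with hg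
  have hgc : ∀ z ∈ Q, ContinuousAt g z := fun z hz => by
    have := (hU z hz).continuousAt
    simp only [hg]
    unfold tiltedCutoff
    fun_prop
  have hgle : ∀ z ∈ Q, g z ≤ 1 - ‖z.1 - P₀.1‖ ^ 2 / ε ^ 2 - (P₀.2 - z.2) / ε ^ 2 := fun z hz => by
    have := mul_nonpos_of_nonneg_of_nonpos hlam0.le
      (sub_nonpos.2 ((le_abs_self _).trans (hbound z hz)))
    simp only [hg, tiltedCutoff]
    linarith
  have hgP₀ : 1 / 2 ≤ g P₀ := by
    have := mul_le_mul_of_nonneg_left (neg_le_of_abs_le (hbound P₀ hP₀)) hlam0.le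
    simp only [hg, tiltedCutoff, sub_self, norm_zero]
    norm_num
    linarith
  have hexp : 0 < Real.exp (K / 2) - 1 := by
    have := Real.add_one_le_exp (K / 2)
    linarith
  have hηP₀ : Real.exp (K / 2) - 1 ≤ Real.exp (K * g P₀) - 1 := by
    gcongr
    nlinarith
  obtain ⟨P, hPQ, hPmax⟩ := hQc.exists_isMaxOn ⟨P₀, hP₀⟩
    (f := fun z => (Real.exp (K * g z) - 1) * √(1 + ‖spatialGradient U z‖ ^ 2))
    (fun z hz => by
      have h₁ := hgc z hz
      have h₂ := (differentiableAt_spatialGradient (hU z hz)).continuousAt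
      exact ContinuousAt.continuousWithinAt (by fun_prop))
  have hPmax' : ∀ z ∈ Q, (Real.exp (K * g z) - 1) * √(1 + ‖spatialGradient U z‖ ^ 2) ≤
      (Real.exp (K * g P) - 1) * √(1 + ‖spatialGradient U P‖ ^ 2) := fun z hz => hPmax hz
  have hsqrt : ∀ z, 0 < √(1 + ‖spatialGradient U z‖ ^ 2) := fun z =>
    Real.sqrt_pos.2 (by positivity)
  have hηP : 0 < Real.exp (K * g P) - 1 := by
    refine pos_of_mul_pos_left (lt_of_lt_of_le ?_ (hPmax' P₀ hP₀)) (hsqrt P).le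
    exact mul_pos (hexp.trans_le hηP₀) (hsqrt P₀)
  have hgP : 0 < g P := by
    have : 0 < K * g P := Real.one_lt_exp_iff.1 (by linarith)
    exact pos_of_mul_pos_right this hK0.le
  have hyP : ‖P.1 - P₀.1‖ ≤ ε := mem_closedBall_iff_norm.1 hPQ.1
  have htP : 0 ≤ P₀.2 - P.2 := sub_nonneg.2 hPQ.2.2
  have hgP1 : g P ≤ 1 := by
    have := hgle P hPQ
    have : 0 ≤ ‖P.1 - P₀.1‖ ^ 2 / ε ^ 2 := by positivity
    have : 0 ≤ (P₀.2 - P.2) / ε ^ 2 := by positivity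
    linarith
  suffices hv : √(1 + ‖spatialGradient U P‖ ^ 2) ≤ V by
    rw [le_div_iff₀ hexp, mul_comm]
    calc _ ≤ (Real.exp (K * g P₀) - 1) * √(1 + ‖spatialGradient U P₀‖ ^ 2) := by gcongr
      _ ≤ _ := hPmax' P₀ hP₀
      _ ≤ Real.exp K * V := by
        gcongr
        have : Real.exp (K * g P) ≤ Real.exp K := Real.exp_le_exp.2 (by nlinarith)
        linarith
  by_contra! hv
  have hy : ‖P.1 - P₀.1‖ < ε := by
    refine hyP.lt_of_ne fun h => ?_
    have h₁ := hgle P hPQ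
    rw [h, div_self (by positivity)] at h₁
    have : 0 ≤ (P₀.2 - P.2) / ε ^ 2 := by positivity
    linarith
  have ht : P₀.2 - ε ^ 2 < P.2 := by
    refine hPQ.2.1.lt_of_ne fun h => ?_
    have h₁ := hgle P hPQ
    rw [← h, sub_sub_cancel, div_self (by positivity)] at h₁
    have : 0 ≤ ‖P.1 - P₀.1‖ ^ 2 / ε ^ 2 := by positivity
    linarith
  have hnear : ∀ᶠ z in 𝓝 P, z.2 ≤ P.2 →
      (Real.exp (K * g z) - 1) * (1 + inner ℝ (spatialGradient U z) (spatialGradient U P)) ≤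
      (Real.exp (K * g P) - 1) * (1 + inner ℝ (spatialGradient U P) (spatialGradient U P)) := by
    have h₁ : ∀ᶠ z in 𝓝 P, ‖z.1 - P₀.1‖ < ε :=
      ContinuousAt.eventually_lt (by fun_prop) continuousAt_const hy
    have h₂ : ∀ᶠ z in 𝓝 P, P₀.2 - ε ^ 2 < z.2 :=
      ContinuousAt.eventually_lt continuousAt_const (by fun_prop) ht
    have h₃ : ∀ᶠ z in 𝓝 P, 0 < g z := continuousAt_const.eventually_lt (hgc P hPQ) hgP
    filter_upwards [h₁, h₂, h₃] with z hz₁ hz₂ hz₃ hz₄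
    have hη : 0 ≤ Real.exp (K * g z) - 1 := by
      have := Real.add_one_le_exp (K * g z)
      have := mul_pos hK0 hz₃
      linarith
    have hzQ : z ∈ Q := ⟨mem_closedBall_iff_norm.2 hz₁.le, hz₂.le, hz₄.trans hPQ.2.2⟩
    calc _ ≤ (Real.exp (K * g z) - 1) *
          (√(1 + ‖spatialGradient U z‖ ^ 2) * √(1 + ‖spatialGradient U P‖ ^ 2)) := by
          gcongr
          exact one_add_inner_le_sqrt_mul_sqrt _ _
      _ = ((Real.exp (K * g z) - 1) * √(1 + ‖spatialGradient U z‖ ^ 2))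
          * √(1 + ‖spatialGradient U P‖ ^ 2) := by ring
      _ ≤ ((Real.exp (K * g P) - 1) * √(1 + ‖spatialGradient U P‖ ^ 2))
          * √(1 + ‖spatialGradient U P‖ ^ 2) :=
          mul_le_mul_of_nonneg_right (hPmax' z hzQ) (hsqrt P).le
      _ = _ := by
          rw [mul_assoc, Real.mul_self_sqrt (by positivity), real_inner_self_eq_norm_sq]
  have hmain := tilted_ellipticity_le e (hU P hPQ) (heq P hPQ) rfl hK0 hε hlam0 hB hyP hgP hnear
  rw [← hC₁] at hmain
  set N := 1 + ‖spatialGradient U P‖ ^ 2 with hN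
  have hv2 : √N ^ 2 = N := Real.sq_sqrt (by positivity)
  have hN4 : 4 ≤ N := by
    have : 2 < √N := (le_max_left _ _).trans_lt (hV ▸ hv)
    nlinarith
  have h₁ : 1 / N ≤ 1 / 4 := one_div_le_one_div_of_le (by norm_num) hN4
  have h₂ : 4 * lam / (ε * √N) ≤ lam ^ 2 / 2 := by
    have : 8 / (ε * lam) < √N := (le_max_right _ _).trans_lt (hV ▸ hv)
    rw [div_lt_iff₀ (by positivity)] at this
    rw [div_le_iff₀ (mul_pos hε (hsqrt P))]
    nlinarith
  have h₃ : lam ^ 2 / 4 ≤ lam ^ 2 * (1 - 1 / N) - 4 * lam / (ε * √N) := by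
    nlinarith [sq_nonneg lam]
  have h₄ : K * (lam ^ 2 / 4) = C₁ + 1 := by rw [hK]; field_simp
  have := mul_le_mul_of_nonneg_left h₃ hK0.le
  linarith

end Space

section EuclideanCoordinates

variable {n : ℕ} {u : EuclideanSpace ℝ (Fin n) → ℝ → ℝ} {x : EuclideanSpace ℝ (Fin n)} {t : ℝ}

theorem pd_eq_spatialGradient
    (hu : DifferentiableAt ℝ (fun p : EuclideanSpace ℝ (Fin n) × ℝ => u p.1 p.2) (x, t))
    (i : Fin n) : pd u t x i = spatialGradient (fun p => u p.1 p.2) (x, t) i := by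
  have h₁ : HasFDerivAt (fun y : EuclideanSpace ℝ (Fin n) => (y, t)) (.inl ℝ _ ℝ) x :=
    hasFDerivAt_prodMk_left x t
  have h₂ := (hu.hasFDerivAt (x := (x, t))).comp x h₁
  have h₃ : fderiv ℝ (fun y => u y t) x = _ := h₂.fderiv
  have h₄ := inner_spatialGradient (fun p : EuclideanSpace ℝ (Fin n) × ℝ => u p.1 p.2) (x, t)
    (EuclideanSpace.single i 1)
  rw [EuclideanSpace.inner_single_right] at h₄
  rw [pd, h₃]
  simpa using h₄.symm

theorem pd2_eq_spatialHessian
    (hu : ContDiffAt ℝ 3 (fun p : EuclideanSpace ℝ (Fin n) × ℝ => u p.1 p.2) (x, t))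
    (i j : Fin n) : pd2 u t x i j = spatialHessian (fun p => u p.1 p.2) (x, t)
      (EuclideanSpace.single i 1) (EuclideanSpace.single j 1) := by
  set U := fun p : EuclideanSpace ℝ (Fin n) × ℝ => u p.1 p.2 with hU
  have h₁ : HasFDerivAt (fun y : EuclideanSpace ℝ (Fin n) => (y, t)) (.inl ℝ _ ℝ) x :=
    hasFDerivAt_prodMk_left x t
  have h₂ := ((differentiableAt_fderiv hu).hasFDerivAt (x := (x, t))).comp x h₁
  have h₃ := h₂.clm_apply (hasFDerivAt_const
    ((EuclideanSpace.single j 1, 0) : EuclideanSpace ℝ (Fin n) × ℝ) x)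
  have h₄ : (fun y => pd u t y j) =ᶠ[𝓝 x]
      fun y => fderiv ℝ U (y, t) (EuclideanSpace.single j 1, 0) := by
    filter_upwards [h₁.continuousAt.eventually (hu.eventually (by simp))] with y hy
    rw [pd_eq_spatialGradient (hy.differentiableAt (by norm_num)), ← inner_spatialGradient,
      EuclideanSpace.inner_single_right]
    simp [hU]
  rw [pd2, h₄.fderiv_eq, spatialHessian_apply]
  exact (DFunLike.congr_fun h₃.fderiv _).trans (by simp)

theorem sum_graph_equation_eq
    (hu : ContDiffAt ℝ 3 (fun p : EuclideanSpace ℝ (Fin n) × ℝ => u p.1 p.2) (x, t)) {N : ℝ} :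
    ∑ i, ∑ j, ((if i = j then (1 : ℝ) else 0) - pd u t x i * pd u t x j / N) * pd2 u t x i j =
      ∑ i, spatialHessian (fun p => u p.1 p.2) (x, t) (EuclideanSpace.basisFun (Fin n) ℝ i)
        (EuclideanSpace.basisFun (Fin n) ℝ i)
      - spatialHessian (fun p => u p.1 p.2) (x, t) (spatialGradient (fun p => u p.1 p.2) (x, t))
        (spatialGradient (fun p => u p.1 p.2) (x, t)) / N := by
  set U := fun p : EuclideanSpace ℝ (Fin n) × ℝ => u p.1 p.2 with hU
  set q := spatialGradient U (x, t) with hq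
  have hrepr : q = ∑ i, q i • EuclideanSpace.single i (1 : ℝ) := by
    simpa using ((EuclideanSpace.basisFun (Fin n) ℝ).sum_repr q).symm
  have hquad : spatialHessian U (x, t) q q = ∑ i, ∑ j, q i * q j *
      spatialHessian U (x, t) (EuclideanSpace.single i 1) (EuclideanSpace.single j 1) := by
    conv_lhs => rw [hrepr]
    simp only [map_sum, sum_apply, map_smul, smul_apply, smul_eq_mul, Finset.mul_sum]
    rw [Finset.sum_comm]
    exact Finset.sum_congr rfl fun i _ => Finset.sum_congr rfl fun j _ => by ring
  simp only [pd_eq_spatialGradient (hu.differentiableAt (by norm_num)), pd2_eq_spatialHessian hu,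
    sub_mul, Finset.sum_sub_distrib, ite_mul, one_mul, zero_mul, Finset.sum_ite_eq,
    Finset.mem_univ, if_true, EuclideanSpace.basisFun_apply]
  rw [hquad, Finset.sum_div]
  congr 1
  refine Finset.sum_congr rfl fun i _ => ?_
  rw [Finset.sum_div]
  exact Finset.sum_congr rfl fun j _ => by ring

theorem sum_pd_sq
    (hu : ContDiffAt ℝ 3 (fun p : EuclideanSpace ℝ (Fin n) × ℝ => u p.1 p.2) (x, t)) :
    ∑ k, pd u t x k ^ 2 = ‖spatialGradient (fun p => u p.1 p.2) (x, t)‖ ^ 2 := by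
  simp only [EuclideanSpace.norm_sq_eq, pd_eq_spatialGradient (hu.differentiableAt (by norm_num)),
    Real.norm_eq_abs, sq_abs]

theorem deriv_time_eq_fderiv
    (hu : DifferentiableAt ℝ (fun p : EuclideanSpace ℝ (Fin n) × ℝ => u p.1 p.2) (x, t)) :
    deriv (fun s => u x s) t = fderiv ℝ (fun p : EuclideanSpace ℝ (Fin n) × ℝ => u p.1 p.2) (x, t)
      (0, 1) := by
  have h := (hu.hasFDerivAt (x := (x, t))).comp_hasDerivAt t
    ((hasDerivAt_const t x).prodMk (hasDerivAt_id t))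
  exact h.deriv

end EuclideanCoordinates

/-- uniform interior gradient estimate. For every `M > 0`, `ε > 0` there is a
constant `C = C(M, ε, n, A)` such that every bounded solution of the graph equation (with
either sign of the driving-force term) on `B_ρ(x₀) × (s₁, s₂)` has `|∇u| ≤ C` on
`B_{ρ−ε}(x₀) × (s₁ + ε², s₂)`. -/
theorem interior_gradient_estimate (n : ℕ) (hn : 1 ≤ n) (A : ℝ) (hA : 0 < A)
    (M ε : ℝ) (hM : 0 < M) (hε : 0 < ε) :
    ∃ C : ℝ, ∀ (x₀ : EuclideanSpace ℝ (Fin n)) (ρ s₁ s₂ : ℝ), 0 < ρ → s₁ < s₂ →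
      ∀ σ : ℝ, (σ = 1 ∨ σ = -1) →
      ∀ u : EuclideanSpace ℝ (Fin n) → ℝ → ℝ,
      ContDiffOn ℝ 3 (fun p : EuclideanSpace ℝ (Fin n) × ℝ => u p.1 p.2)
        (Metric.ball x₀ ρ ×ˢ Set.Ioo s₁ s₂) →
      (∀ x t, (x, t) ∈ Metric.ball x₀ ρ ×ˢ Set.Ioo s₁ s₂ →
        deriv (fun s => u x s) t =
          (∑ i, ∑ j, ((if i = j then (1 : ℝ) else 0)
              - pd u t x i * pd u t x j / (1 + ∑ k, (pd u t x k) ^ 2)) * pd2 u t x i j)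
            + σ * A * Real.sqrt (1 + ∑ k, (pd u t x k) ^ 2)) →
      (∀ x t, (x, t) ∈ closure (Metric.ball x₀ ρ ×ˢ Set.Ioo s₁ s₂) → |u x t| ≤ M) →
      ∀ x t, (x, t) ∈ Metric.ball x₀ (ρ - ε) ×ˢ Set.Ioo (s₁ + ε ^ 2) s₂ →
        Real.sqrt (∑ i, (pd u t x i) ^ 2) ≤ C := by
  obtain ⟨C₁, hC₁⟩ : ∃ C₁, C₁ = (1 + 2 * Fintype.card (Fin n)) / ε ^ 2 + 1 / (4 * M) * A
    + 2 * A / ε := ⟨_, rfl⟩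
  obtain ⟨K, hK⟩ : ∃ K, K = 4 * (C₁ + 1) / (1 / (4 * M)) ^ 2 := ⟨_, rfl⟩
  obtain ⟨V, hV⟩ : ∃ V, V = max 2 (8 / (ε * (1 / (4 * M)))) := ⟨_, rfl⟩
  refine ⟨Real.exp K * V / (Real.exp (K / 2) - 1), ?_⟩
  intro x₀ ρ s₁ s₂ _ _ σ hσ u hu heq hbound x t hxt
  set Ω := Metric.ball x₀ ρ ×ˢ Set.Ioo s₁ s₂ with hΩ
  have hΩo : IsOpen Ω := Metric.isOpen_ball.prod isOpen_Ioo
  have hcd : ∀ z ∈ Ω, ContDiffAt ℝ 3 (fun p : EuclideanSpace ℝ (Fin n) × ℝ => u p.1 p.2) z :=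
    fun z hz => hu.contDiffAt (hΩo.mem_nhds hz)
  have hsub : Metric.closedBall x ε ×ˢ Set.Icc (t - ε ^ 2) t ⊆ Ω := by
    refine Set.prod_mono ?_ ?_
    · refine Metric.closedBall_subset_ball' ?_
      have := Metric.mem_ball.1 hxt.1
      linarith
    · exact fun r hr => ⟨by linarith [hr.1, hxt.2.1], hr.2.trans_lt hxt.2.2⟩
  have hx : (x, t) ∈ Ω := hsub ⟨Metric.mem_closedBall_self hε.le, by simp [sq_nonneg], le_rfl⟩
  have hB : |σ * A| ≤ A := by
    rcases hσ with rfl | rfl <;> simp [abs_of_pos hA]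
  have hgrad := sqrt_one_add_norm_spatialGradient_sq_le (EuclideanSpace.basisFun (Fin n) ℝ)
    hM hε hB hC₁ hK hV (P₀ := (x, t)) (fun z hz => hcd z (hsub hz))
    (fun P hP => by
      filter_upwards [hΩo.mem_nhds (hsub hP)] with z hz
      have h := heq z.1 z.2 hz
      rwa [deriv_time_eq_fderiv ((hcd z hz).differentiableAt (by norm_num)),
        sum_graph_equation_eq (hcd z hz), sum_pd_sq (hcd z hz)] at h)
    (fun z hz => hbound z.1 z.2 (subset_closure (hsub hz)))
  rw [sum_pd_sq (hcd _ hx)]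
  exact (Real.sqrt_le_sqrt (by linarith)).trans hgrad
end

section
/- Let n ≥ 2 be an integer and A > 0. If α : (−∞, 0] → (0, ∞) is differentiable with α'(t) = A − (n−1)/α(t) for all t ≤ 0, then α(t) → (n−1)/A as t → −∞. -/
/-- Backward Grönwall estimate: if `w' ≥ k w` on `(−∞, 0]`, then `w t ≤ w 0 * exp (k t)` there. -/
theorem le_mul_exp_of_mul_le_deriv_Iic {w w' : ℝ → ℝ} {k : ℝ}
    (hw : ∀ t ≤ 0, HasDerivWithinAt w (w' t) (Set.Iic 0) t)
    (hk : ∀ t ≤ 0, k * w t ≤ w' t) {t : ℝ} (ht : t ≤ 0) :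
    w t ≤ w 0 * Real.exp (k * t) := by
  have hd : ∀ s ≤ 0, HasDerivWithinAt (fun s => w s * Real.exp (-(k * s)))
      ((w' s - k * w s) * Real.exp (-(k * s))) (Set.Iic 0) s := by
    intro s hs
    have he : HasDerivAt (fun s : ℝ => Real.exp (-(k * s)))
        (Real.exp (-(k * s)) * (-(k * 1))) s :=
      (((hasDerivAt_id s).const_mul k).neg).exp
    exact ((hw s hs).mul he.hasDerivWithinAt).congr_deriv (by ring)
  have hi {s : ℝ} (hs : s ∈ interior (Set.Iic (0 : ℝ))) : s ≤ 0 :=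
    Set.mem_Iic.1 (interior_subset hs)
  have hmono : MonotoneOn (fun s => w s * Real.exp (-(k * s))) (Set.Iic 0) := by
    refine monotoneOn_of_hasDerivWithinAt_nonneg (convex_Iic 0)
      (fun s hs => (hd s hs).continuousWithinAt)
      (fun s hs => (hd s (hi hs)).mono interior_subset) fun s hs => ?_
    exact mul_nonneg (sub_nonneg.2 (hk s (hi hs))) (Real.exp_pos _).le
  have h : w t * Real.exp (-(k * t)) ≤ w 0 := by
    simpa using hmono (Set.mem_Iic.2 ht) (Set.mem_Iic.2 le_rfl) ht
  calc w t = w t * Real.exp (-(k * t)) * Real.exp (k * t) := by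
        rw [mul_assoc, ← Real.exp_add, neg_add_cancel, Real.exp_zero, mul_one]
    _ ≤ w 0 * Real.exp (k * t) := by gcongr

/-- every ancient positive solution of `α' = A − (n−1)/α` (defined on
`(−∞, 0]`) emanates from the equilibrium: `α(t) → (n−1)/A` as `t → −∞`. -/
theorem cylinder_ode_ancient (n : ℕ) (hn : 2 ≤ n) (A : ℝ) (hA : 0 < A)
    (α : ℝ → ℝ) (hpos : ∀ t : ℝ, t ≤ 0 → 0 < α t)
    (hderiv : ∀ t : ℝ, t ≤ 0 →
      HasDerivWithinAt α (A - ((n : ℝ) - 1) / α t) (Set.Iic 0) t) :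
    Filter.Tendsto α Filter.atBot (nhds (((n : ℝ) - 1) / A)) := by
  set c : ℝ := ((n : ℝ) - 1) / A with hc
  have hn1 : (n : ℝ) - 1 = A * c := by rw [hc]; field_simp
  have hcpos : 0 < c := by
    have : (2 : ℝ) ≤ n := by exact_mod_cast hn
    exact div_pos (by linarith) hA
  have hw : ∀ t ≤ 0, HasDerivWithinAt (fun t => (α t - c) ^ 2)
      (2 * A / α t * (α t - c) ^ 2) (Set.Iic 0) t := by
    intro t ht
    have hα := (hpos t ht).ne'
    refine (((hderiv t ht).sub_const c).pow 2).congr_deriv ?_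
    rw [hn1]
    field_simp
    ring
  have hle : ∀ t ≤ 0, α t ≤ c + |α 0 - c| := by
    intro t ht
    have h := le_mul_exp_of_mul_le_deriv_Iic (k := 0) hw (fun s hs => by
      have := hpos s hs
      rw [zero_mul]
      positivity) ht
    rw [zero_mul, Real.exp_zero, mul_one] at h
    linarith [le_abs_self (α t - c), sq_le_sq.1 h]
  set M : ℝ := c + |α 0 - c| with hM
  have hMpos : 0 < M := by positivity
  have hbound : ∀ t ≤ 0, (α t - c) ^ 2 ≤ (α 0 - c) ^ 2 * Real.exp (2 * A / M * t) := by
    intro t ht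
    refine le_mul_exp_of_mul_le_deriv_Iic hw (fun s hs => ?_) ht
    have := hpos s hs
    have := hle s hs
    gcongr
  have hexp : Filter.Tendsto (fun t => (α 0 - c) ^ 2 * Real.exp (2 * A / M * t))
      Filter.atBot (nhds 0) := by
    have hk : 0 < 2 * A / M := by positivity
    simpa using (Real.tendsto_exp_atBot.comp
      (Filter.tendsto_id.const_mul_atBot hk)).const_mul ((α 0 - c) ^ 2)
  have hsq : Filter.Tendsto (fun t => (α t - c) ^ 2) Filter.atBot (nhds 0) := by
    refine squeeze_zero' (Filter.Eventually.of_forall fun t => sq_nonneg _) ?_ hexp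
    filter_upwards [Filter.eventually_le_atBot (0 : ℝ)] with t ht using hbound t ht
  rw [tendsto_iff_dist_tendsto_zero]
  simpa [Real.sqrt_sq_eq_abs, Real.dist_eq] using hsq.sqrt
end

section
/- Let V ⊂ ℝᴺ be a nonempty compact set, let a < b, and let v : V × (a, b) → ℝ be continuous with continuous time derivative ∂_t v. Define m(t) = max{v(x, t) : x ∈ V}. Then for every t ∈ (a, b) the upper right Dini derivative of m satisfies limsup_{h → 0⁺} (m(t+h) − m(t))/h ≤ max{∂_t v(x, t) : x ∈ V, v(x, t) = m(t)}. In particular, at every time t at which m is differentiable there exists a point P_t ∈ V with v(P_t, t) = m(t) and m'(t) ≤ ∂_t v(P_t, t). -/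
open Set Filter Topology

/-- If `c` strictly bounds the time derivative at all points of a compact set where `v(·, t)`
reaches the level `M`, then `v(·, s)` stays below `M + c (s - t)` just after time `t`. -/
lemma IsCompact.eventually_forall_le_add_mul {X : Type*} [PseudoMetricSpace X] {V : Set X}
    (hV : IsCompact V) {a b t M c : ℝ} (ht : t ∈ Ioo a b) {v vt : X → ℝ → ℝ}
    (hv : ContinuousOn (fun p : X × ℝ => v p.1 p.2) (V ×ˢ Ioo a b))
    (hvt : ∀ x ∈ V, ∀ s ∈ Ioo a b, HasDerivAt (v x) (vt x s) s)
    (hvtc : ContinuousOn (fun p : X × ℝ => vt p.1 p.2) (V ×ˢ Ioo a b))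
    (hM : ∀ x ∈ V, v x t ≤ M) (hc : ∀ x ∈ V, v x t = M → vt x t < c) :
    ∀ᶠ s in 𝓝[>] t, ∀ x ∈ V, v x s ≤ M + c * (s - t) := by
  suffices h : ∀ᶠ s in 𝓝 t, ∀ x ∈ V, x ∈ V → t < s → v x s ≤ M + c * (s - t) by
    filter_upwards [h.filter_mono nhdsWithin_le_nhds, self_mem_nhdsWithin] with s hs hts x hx
    exact hs x hx hx hts
  apply hV.eventually_forall_of_forall_eventually
  intro x hx
  suffices h : ∀ᶠ p : X × ℝ in 𝓝 (x, t), p.1 ∈ V → t < p.2 → v p.1 p.2 ≤ M + c * (p.2 - t) from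
    (continuous_swap.tendsto (t, x)).eventually h
  have hab : ∀ᶠ p : X × ℝ in 𝓝 (x, t), p.2 ∈ Ioo a b :=
    continuous_snd.continuousAt.eventually (isOpen_Ioo.mem_nhds ht)
  rcases (hM x hx).lt_or_eq with hlt | heq
  · have hcont : ContinuousOn (fun p : X × ℝ => v p.1 p.2 - c * (p.2 - t)) (V ×ˢ Ioo a b) :=
      hv.sub (by fun_prop)
    have hnear := (hcont (x, t) ⟨hx, ht⟩).eventually_lt_const (u := M) (by simpa using hlt)
    rw [eventually_nhdsWithin_iff] at hnear
    filter_upwards [hnear, hab] with p hp hp' hpV _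
    linarith [hp ⟨hpV, hp'⟩]
  · have hnear := (hvtc (x, t) ⟨hx, ht⟩).eventually_lt_const (hc x hx heq)
    rw [eventually_nhdsWithin_iff] at hnear
    obtain ⟨ε, hε, hball⟩ := Metric.eventually_nhds_iff.1 (hnear.and hab)
    refine Metric.eventually_nhds_iff.2 ⟨ε, hε, ?_⟩
    rintro ⟨y, s⟩ hys hy hts
    have hbetween : ∀ r ∈ Icc t s, r ∈ Ioo a b ∧ vt y r < c := by
      intro r hr
      have hdist : dist (y, r) (x, t) < ε := by
        rw [Prod.dist_eq, max_lt_iff, Real.dist_eq] at hys ⊢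
        refine ⟨hys.1, lt_of_le_of_lt ?_ hys.2⟩
        exact abs_le_abs_of_nonneg (sub_nonneg.2 hr.1) (sub_le_sub_right hr.2 t)
      have := hball hdist
      exact ⟨this.2, this.1 ⟨hy, this.2⟩⟩
    obtain ⟨r, hr, hslope⟩ := exists_hasDerivAt_eq_slope (v y) (vt y) hts
      (fun r hr => (hvt y hy r (hbetween r hr).1).continuousAt.continuousWithinAt)
      (fun r hr => hvt y hy r (hbetween r (Ioo_subset_Icc_self hr)).1)
    have hlt := (hbetween r (Ioo_subset_Icc_self hr)).2
    rw [hslope, div_lt_iff₀ (sub_pos.2 hts)] at hlt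
    dsimp only at hlt ⊢
    linarith [hM y hy]

/-- Among the maximizers of a continuous function on a compact set, a second continuous function
attains its maximum. -/
lemma IsCompact.exists_isMaxOn_maximizers {X : Type*} [TopologicalSpace X]
    {V : Set X} (hV : IsCompact V) {f g : X → ℝ} (hf : ContinuousOn f V)
    (hg : ContinuousOn g V) {M : ℝ} (hM : M ∈ f '' V) :
    ∃ P ∈ V, f P = M ∧ ∀ x ∈ V, f x = M → g x ≤ g P := by
  have hK : IsCompact (V ∩ f ⁻¹' {M}) := by
    obtain ⟨u, hu, huV⟩ := continuousOn_iff_isClosed.1 hf {M} isClosed_singleton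
    rw [inter_comm, huV, inter_comm]
    exact hV.inter_right hu
  obtain ⟨P, hP, hmax⟩ := hK.exists_isMaxOn hM (hg.mono inter_subset_left)
  exact ⟨P, hP.1, hP.2, fun x hx hxM => hmax ⟨hx, hxM⟩⟩

/-- Hamilton's trick. For `v` continuous on compact `V × (a,b)` with
continuous time derivative `vt`, and `m(t) = max_{x ∈ V} v(x, t)`, the upper right Dini
derivative of `m` is bounded by the maximum of `vt(·, t)` over the maximizers, and at every
differentiability time of `m` there is a maximizer `P` with `m'(t) ≤ vt(P, t)`. -/
theorem hamiltons_trick (N : ℕ) (V : Set (EuclideanSpace ℝ (Fin N)))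
    (hVne : V.Nonempty) (hVc : IsCompact V) (a b : ℝ) (hab : a < b)
    (v vt : EuclideanSpace ℝ (Fin N) → ℝ → ℝ)
    (hv : ContinuousOn (fun p : EuclideanSpace ℝ (Fin N) × ℝ => v p.1 p.2)
      (V ×ˢ Set.Ioo a b))
    (hvt : ∀ x ∈ V, ∀ t ∈ Set.Ioo a b, HasDerivAt (v x) (vt x t) t)
    (hvtc : ContinuousOn (fun p : EuclideanSpace ℝ (Fin N) × ℝ => vt p.1 p.2)
      (V ×ˢ Set.Ioo a b))
    (m : ℝ → ℝ) (hm : ∀ t ∈ Set.Ioo a b, IsGreatest ((fun x => v x t) '' V) (m t)) :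
    (∀ t ∈ Set.Ioo a b,
      Filter.limsup (fun h => (m (t + h) - m t) / h) (nhdsWithin 0 (Set.Ioi 0))
        ≤ sSup {y : ℝ | ∃ x ∈ V, v x t = m t ∧ y = vt x t})
    ∧ ∀ t ∈ Set.Ioo a b, DifferentiableAt ℝ m t →
        ∃ P ∈ V, v P t = m t ∧ deriv m t ≤ vt P t := by
  have hmaximizer : ∀ t ∈ Ioo a b, ∃ P ∈ V, v P t = m t ∧
      (∀ x ∈ V, v x t = m t → vt x t ≤ vt P t) ∧
      ∀ c > vt P t, ∀ᶠ h in 𝓝[>] (0 : ℝ), (m (t + h) - m t) / h ≤ c := by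
    intro t ht
    have hslice : ContinuousOn (fun x : EuclideanSpace ℝ (Fin N) => (x, t)) V := by fun_prop
    have hmaps : MapsTo (fun x : EuclideanSpace ℝ (Fin N) => (x, t)) V (V ×ˢ Ioo a b) :=
      fun x hx => ⟨hx, ht⟩
    obtain ⟨P, hP, hPm, hmax⟩ := hVc.exists_isMaxOn_maximizers (hv.comp hslice hmaps)
      (hvtc.comp hslice hmaps) (hm t ht).1
    refine ⟨P, hP, hPm, hmax, fun c hc => ?_⟩
    have hle := hVc.eventually_forall_le_add_mul ht hv hvt hvtc
      (fun x hx => (hm t ht).2 (mem_image_of_mem _ hx)) fun x hx hxm => (hmax x hx hxm).trans_lt hc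
    have hIoo : ∀ᶠ s in 𝓝[>] t, s ∈ Ioo a b :=
      nhdsWithin_le_nhds (isOpen_Ioo.mem_nhds ht)
    have hshift : Tendsto (fun h => t + h) (𝓝[>] (0 : ℝ)) (𝓝[>] t) := by
      refine tendsto_nhdsWithin_iff.2 ⟨?_, ?_⟩
      · exact (Continuous.tendsto' (by fun_prop) _ _ (add_zero t)).mono_left nhdsWithin_le_nhds
      · filter_upwards [self_mem_nhdsWithin] with h hh
        simpa using hh
    filter_upwards [hshift.eventually (hle.and hIoo), self_mem_nhdsWithin] with h ⟨hh, hs⟩ hpos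
    obtain ⟨x, hx, hxm⟩ := (hm _ hs).1
    rw [div_le_iff₀ hpos, ← hxm]
    linarith [hh x hx, congrArg (c * ·) (add_sub_cancel_left t h)]
  refine ⟨fun t ht => ?_, fun t ht hdiff => ?_⟩
  · obtain ⟨P, hP, hPm, hmax, hbound⟩ := hmaximizer t ht
    have hsSup : sSup {y : ℝ | ∃ x ∈ V, v x t = m t ∧ y = vt x t} = vt P t := by
      refine IsGreatest.csSup_eq ⟨⟨P, hP, hPm, rfl⟩, ?_⟩
      rintro _ ⟨x, hx, hxm, rfl⟩
      exact hmax x hx hxm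
    rw [hsSup]
    -- The quotients are bounded below by those of `v P`, so the real `limsup` is not a junk value.
    have hlower : ∀ᶠ h in 𝓝[>] (0 : ℝ), vt P t - 1 ≤ (m (t + h) - m t) / h := by
      have hslope := (hvt P hP t ht).tendsto_slope_zero_right.eventually_const_lt
        (sub_one_lt (vt P t))
      have hIoo : ∀ᶠ h in 𝓝[>] (0 : ℝ), t + h ∈ Ioo a b :=
        nhdsWithin_le_nhds ((continuous_const_add t).continuousAt.eventually
          (isOpen_Ioo.mem_nhds (by simpa using ht)))
      filter_upwards [hslope, hIoo, self_mem_nhdsWithin] with h hh hs hpos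
      refine hh.le.trans ?_
      rw [smul_eq_mul, inv_mul_eq_div, hPm]
      have : v P (t + h) ≤ m (t + h) := (hm _ hs).2 (mem_image_of_mem _ hP)
      exact div_le_div_of_nonneg_right (by linarith) (le_of_lt hpos)
    refine le_of_forall_gt_imp_ge_of_dense fun c hc => ?_
    exact limsup_le_of_le (isCoboundedUnder_le_of_eventually_le _ hlower) (hbound c hc)
  · obtain ⟨P, hP, hPm, -, hbound⟩ := hmaximizer t ht
    refine ⟨P, hP, hPm, le_of_forall_gt_imp_ge_of_dense fun c hc => ?_⟩
    refine le_of_tendsto hdiff.hasDerivAt.tendsto_slope_zero_right ?_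
    filter_upwards [hbound c hc] with h hh
    rwa [smul_eq_mul, inv_mul_eq_div]
end
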